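/- Let 0 < λ ≤ Λ and N ≥ 2 an integer with Ñ := (λ/Λ)(N−1) + 1 > 2. Assume: (a) there exists a normalized fast-decaying entire solution U at exponent p⋆ > 1, with fast-decay constant c₁ > 0 and inflection radius R₀ > 0; (b) the Dirichlet problem in the unit ball with exponent p⋆ has no positive radial solution. Let εₙ → 0⁺ with pₙ := p⋆ − εₙ > 1, let uₙ be positive radial solutions of the Dirichlet problem with exponent pₙ having a unique inflection radius r₀(n) ∈ (0,1), set Mₙ := uₙ(0) and define the rescaled functions ũₙ(r) := Mₙ⁻¹·uₙ(Mₙ^{−(pₙ−1)/2}·r) for 0 ≤ r ≤ ρₙ := Mₙ^{(pₙ−1)/2}. Then ũₙ → U in C²_loc([0,∞)): for every R > 0, for all n large enough ρₙ ≥ R and sup_{0 ≤ r ≤ R} ( |ũₙ(r) − U(r)| + |ũₙ'(r) − U'(r)| + |ũₙ''(r) − U''(r)| ) → 0 as n → ∞. -/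

import Mathlib

open Real Filter Set

/-- The radial Pucci maximal operator `M⁺_{λ,Λ}` applied to a radial C² function `u`
of the radial variable `r`. -/
noncomputable def radialPucci (lam Lam : ℝ) (N : ℕ) (u : ℝ → ℝ) (r : ℝ) : ℝ :=
  Lam * max (deriv (deriv u) r) 0 + lam * min (deriv (deriv u) r) 0 +
    ((N : ℝ) - 1) * (Lam * max (deriv u r / r) 0 + lam * min (deriv u r / r) 0)

/-- A positive radial solution of the Dirichlet problem `-M⁺[u] = u^q` in the unit ball. -/
def IsDirichletSol (lam Lam : ℝ) (N : ℕ) (q : ℝ) (u : ℝ → ℝ) : Prop :=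
  ContDiffOn ℝ 2 u (Set.Icc 0 1) ∧
    (∀ r ∈ Set.Ico (0 : ℝ) 1, 0 < u r) ∧
    u 1 = 0 ∧ deriv u 0 = 0 ∧
    (∀ r ∈ Set.Icc (0 : ℝ) 1, deriv u r ≤ 0) ∧
    (∀ r ∈ Set.Ioo (0 : ℝ) 1, -radialPucci lam Lam N u r = u r ^ q)

/-- `r0 ∈ (0,1)` is the (unique) inflection radius of `u` in the unit ball. -/
def InflectionAt (u : ℝ → ℝ) (r0 : ℝ) : Prop :=
  r0 ∈ Set.Ioo (0 : ℝ) 1 ∧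
    (∀ r ∈ Set.Ico (0 : ℝ) r0, deriv (deriv u) r < 0) ∧
    deriv (deriv u) r0 = 0 ∧
    (∀ r ∈ Set.Ioo r0 (1 : ℝ), 0 < deriv (deriv u) r)

/-- A normalized fast-decaying entire radial solution of `-M⁺[U] = U^{p⋆}` in `ℝ^N`,
with fast-decay constant `c1` and inflection radius `R0`. -/
def IsEntireSol (lam Lam : ℝ) (N : ℕ) (Ntil pstar c1 R0 : ℝ) (U : ℝ → ℝ) : Prop :=
  ContDiffOn ℝ 2 U (Set.Ici 0) ∧
    (∀ r : ℝ, 0 ≤ r → 0 < U r) ∧ U 0 = 1 ∧ deriv U 0 = 0 ∧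
    (∀ r : ℝ, 0 < r → deriv U r < 0) ∧
    (∀ r : ℝ, 0 < r → -radialPucci lam Lam N U r = U r ^ pstar) ∧
    0 < R0 ∧
    (∀ r ∈ Set.Ico (0 : ℝ) R0, deriv (deriv U) r < 0) ∧
    deriv (deriv U) R0 = 0 ∧
    (∀ r : ℝ, R0 < r → 0 < deriv (deriv U) r) ∧
    0 < c1 ∧
    Filter.Tendsto (fun r : ℝ => r ^ (Ntil - 2) * U r) Filter.atTop (nhds c1) ∧
    Filter.Tendsto (fun r : ℝ => r ^ (Ntil - 1) * deriv U r) Filter.atTop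
      (nhds (-(Ntil - 2) * c1))

open Topology

/-- A solution on `[0, T)` of the initial value problem for the decreasing radial profiles of the
Pucci equation `-M⁺[y] = y ^ p`, normalised by `y 0 = 1`; the weight `k` is `(N - 1) * lam`. -/
structure RadialIVP (lam Lam k p T : ℝ) (y : ℝ → ℝ) : Prop where
  cont : ContinuousOn y (Icc 0 T)
  hasDeriv : ∀ r ∈ Ico 0 T, HasDerivWithinAt y (deriv y r) (Ici r) r
  hasDeriv₂ : ∀ r ∈ Ico 0 T, HasDerivAt (deriv y) (deriv (deriv y) r) r
  zero : y 0 = 1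
  deriv_zero : deriv y 0 = 0
  mem : ∀ r ∈ Ico 0 T, y r ∈ Ioc 0 1
  eqn : ∀ r ∈ Ioo 0 T, Lam * max (deriv (deriv y) r) 0 + lam * min (deriv (deriv y) r) 0 +
    k * (deriv y r / r) = -y r ^ p

lemma hasDeriv_of_contDiffOn {T : ℝ} {y : ℝ → ℝ} (hT : 0 < T)
    (hy : ContDiffOn ℝ 2 y (Icc 0 T)) (h2 : deriv (deriv y) 0 ≠ 0) :
    (∀ r ∈ Ico 0 T, HasDerivWithinAt y (deriv y r) (Ici r) r) ∧
    (∀ r ∈ Ico 0 T, HasDerivAt (deriv y) (deriv (deriv y) r) r) := by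
  have hint : ∀ r ∈ Ioo 0 T, ContDiffAt ℝ 2 y r := fun r hr =>
    (hy r (Ioo_subset_Icc_self hr)).contDiffAt (Icc_mem_nhds hr.1 hr.2)
  have hd0 : DifferentiableAt ℝ (deriv y) 0 := differentiableAt_of_deriv_ne_zero h2
  constructor
  · intro r hr
    rcases hr.1.eq_or_lt with rfl | h0
    · refine hasDerivWithinAt_Ici_of_tendsto_deriv (s := Ioo 0 T)
        (fun x hx => ((hint x hx).differentiableAt (by norm_num)).differentiableWithinAt)
        ((hy.continuousOn 0 (left_mem_Icc.2 hT.le)).mono Ioo_subset_Icc_self)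
        (Ioo_mem_nhdsGT hT) (hd0.continuousAt.tendsto.mono_left nhdsWithin_le_nhds)
    · exact ((hint r ⟨h0, hr.2⟩).differentiableAt (by norm_num)).hasDerivAt.hasDerivWithinAt
  · intro r hr
    rcases hr.1.eq_or_lt with rfl | h0
    · exact hd0.hasDerivAt
    · have h : ContDiffAt ℝ 1 (deriv y) r := (hint r ⟨h0, hr.2⟩).derivWithin (by norm_num)
      exact (h.differentiableAt (by norm_num)).hasDerivAt

lemma RadialIVP.of_contDiffOn {lam Lam p T : ℝ} {N : ℕ} {y : ℝ → ℝ} (hT : 0 < T)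
    (hy : ContDiffOn ℝ 2 y (Icc 0 T)) (h2 : deriv (deriv y) 0 ≠ 0)
    (hpos : ∀ r ∈ Ico 0 T, 0 < y r) (hzero : y 0 = 1) (hd : deriv y 0 = 0)
    (hneg : ∀ r ∈ Ioo 0 T, deriv y r ≤ 0)
    (heq : ∀ r ∈ Ioo 0 T, -radialPucci lam Lam N y r = y r ^ p) :
    RadialIVP lam Lam (((N : ℝ) - 1) * lam) p T y := by
  obtain ⟨h₁, h₂⟩ := hasDeriv_of_contDiffOn hT hy h2
  have hanti : AntitoneOn y (Icc 0 T) := by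
    refine antitoneOn_of_deriv_nonpos (convex_Icc 0 T) hy.continuousOn ?_ ?_
    · rw [interior_Icc]
      intro r hr
      exact ((hy r (Ioo_subset_Icc_self hr)).contDiffAt
        (Icc_mem_nhds hr.1 hr.2)).differentiableAt (by norm_num) |>.differentiableWithinAt
    · rwa [interior_Icc]
  refine ⟨hy.continuousOn, h₁, h₂, hzero, hd, fun r hr => ⟨hpos r hr, ?_⟩, fun r hr => ?_⟩
  · exact hzero ▸ hanti (left_mem_Icc.2 hT.le) ⟨hr.1, hr.2.le⟩ hr.1
  · have hdiv : deriv y r / r ≤ 0 := div_nonpos_of_nonpos_of_nonneg (hneg r hr) hr.1.le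
    have := heq r hr
    rw [radialPucci, max_eq_right hdiv, min_eq_left hdiv] at this
    linarith

lemma radialPucci_rescale (lam Lam : ℝ) (N : ℕ) (u : ℝ → ℝ) {a b : ℝ} (ha : 0 < a) (hb : 0 < b)
    (r : ℝ) : radialPucci lam Lam N (fun s => a * u (b * s)) r =
      a * b ^ 2 * radialPucci lam Lam N u (b * r) := by
  have h₁ : deriv (fun s => a * u (b * s)) = fun s => a * b * deriv u (b * s) := by
    ext s
    rw [deriv_const_mul_field, deriv_comp_mul_left]
    simp [mul_assoc]
  have h₂ : deriv (deriv (fun s => a * u (b * s))) r = a * b ^ 2 * deriv (deriv u) (b * r) := by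
    rw [h₁, deriv_const_mul_field, deriv_comp_mul_left]
    simp only [smul_eq_mul]
    ring
  have h₃ : a * b * deriv u (b * r) / r = a * b ^ 2 * (deriv u (b * r) / (b * r)) := by
    rcases eq_or_ne r 0 with rfl | hr
    · simp
    · field_simp
  have hc : 0 ≤ a * b ^ 2 := by positivity
  have hmax : ∀ x, max (a * b ^ 2 * x) 0 = a * b ^ 2 * max x 0 := fun x => by
    rw [mul_max_of_nonneg _ _ hc, mul_zero]
  have hmin : ∀ x, min (a * b ^ 2 * x) 0 = a * b ^ 2 * min x 0 := fun x => by
    rw [mul_min_of_nonneg _ _ hc, mul_zero]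
  simp only [radialPucci, h₂]
  simp only [h₁, h₃, hmax, hmin]
  ring

lemma IsDirichletSol.rescale {lam Lam q : ℝ} {N : ℕ} {u : ℝ → ℝ}
    (hu : IsDirichletSol lam Lam N q u) (h2 : deriv (deriv u) 0 ≠ 0) :
    RadialIVP lam Lam (((N : ℝ) - 1) * lam) q (u 0 ^ ((q - 1) / 2))
      (fun r => (u 0)⁻¹ * u (u 0 ^ (-(q - 1) / 2) * r)) := by
  obtain ⟨hC, hpos, -, hd, hneg, heq⟩ := hu
  have hM : 0 < u 0 := hpos 0 (by simp)
  set b := u 0 ^ (-(q - 1) / 2) with hb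
  set T := u 0 ^ ((q - 1) / 2) with hT
  have hb0 : 0 < b := rpow_pos_of_pos hM _
  have hT0 : 0 < T := rpow_pos_of_pos hM _
  have hbT : b * T = 1 := by
    rw [hb, hT, ← rpow_add hM]
    ring_nf
    simp
  have hab : (u 0)⁻¹ * b ^ 2 = ((u 0)⁻¹) ^ q := by
    rw [hb, ← rpow_natCast, ← rpow_mul hM.le, inv_rpow hM.le, ← rpow_neg hM.le,
      ← rpow_neg_one, ← rpow_add hM]
    congr 1
    push_cast
    ring
  have hlt : ∀ r, r < T → b * r < 1 := fun r hr => hbT ▸ mul_lt_mul_of_pos_left hr hb0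
  have hIcc : MapsTo (fun r => b * r) (Icc 0 T) (Icc 0 1) := fun r hr =>
    ⟨mul_nonneg hb0.le hr.1, hbT ▸ mul_le_mul_of_nonneg_left hr.2 hb0.le⟩
  have h₁ : deriv (fun s => (u 0)⁻¹ * u (b * s)) = fun s => (u 0)⁻¹ * b * deriv u (b * s) := by
    ext s
    rw [deriv_const_mul_field, deriv_comp_mul_left]
    simp [mul_assoc]
  refine RadialIVP.of_contDiffOn hT0 ?_ ?_ ?_ ?_ ?_ ?_ ?_
  · exact contDiffOn_const.mul (hC.comp (by fun_prop) hIcc)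
  · rw [h₁, deriv_const_mul_field, deriv_comp_mul_left]
    simp only [mul_zero, smul_eq_mul]
    exact mul_ne_zero (by positivity) (mul_ne_zero hb0.ne' h2)
  · exact fun r hr => mul_pos (inv_pos.2 hM) (hpos _ ⟨mul_nonneg hb0.le hr.1, hlt r hr.2⟩)
  · simp [hM.ne']
  · simp [h₁, hd]
  · intro r hr
    rw [h₁]
    exact mul_nonpos_of_nonneg_of_nonpos (by positivity) (hneg _ (hIcc ⟨hr.1.le, hr.2.le⟩))
  · intro r hr
    have hr' : b * r ∈ Ioo 0 1 := ⟨mul_pos hb0 hr.1, hlt r hr.2⟩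
    rw [radialPucci_rescale lam Lam N u (inv_pos.2 hM) hb0, ← mul_neg, heq _ hr', hab,
      mul_rpow (inv_pos.2 hM).le (hpos _ ⟨hr'.1.le, hr'.2⟩).le]

lemma abs_rpow_sub_rpow_le {p x y : ℝ} (hp : 1 ≤ p) (hx : x ∈ Ioc 0 1) (hy : y ∈ Ioc 0 1) :
    |x ^ p - y ^ p| ≤ p * |x - y| := by
  refine Convex.norm_image_sub_le_of_norm_hasDerivWithin_le (s := Ioc (0 : ℝ) 1)
    (f := fun z => z ^ p) (f' := fun z => p * z ^ (p - 1))
    (fun z hz => (Real.hasDerivAt_rpow_const (Or.inl hz.1.ne')).hasDerivWithinAt)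
    (fun z hz => ?_) (convex_Ioc 0 1) hy hx
  have h := rpow_le_one hz.1.le hz.2 (sub_nonneg.2 hp)
  have h0 := rpow_nonneg hz.1.le (p - 1)
  rw [Real.norm_of_nonneg (by positivity)]
  nlinarith

lemma abs_rpow_sub_exponent_le {p e x : ℝ} (he : 0 ≤ e) (hpe : 1 ≤ p - e) (hx : x ∈ Ioc 0 1) :
    |x ^ (p - e) - x ^ p| ≤ e := by
  have hsplit : x ^ p = x ^ (p - e) * x ^ e := by rw [← rpow_add hx.1]; ring_nf
  have h1 : x ^ (p - e) ≤ x := by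
    simpa using rpow_le_rpow_of_exponent_ge hx.1 hx.2 hpe
  have h0 : 0 < x ^ (p - e) := rpow_pos_of_pos hx.1 _
  have h2 : x ^ e ≤ 1 := rpow_le_one hx.1.le hx.2 he
  have h3 : 1 + e * log x ≤ x ^ e := by
    rw [rpow_def_of_pos hx.1]
    linarith [add_one_le_exp (log x * e)]
  have h4 : x * (-log x) ≤ 1 := by
    have := log_le_sub_one_of_pos (inv_pos.2 hx.1)
    rw [log_inv] at this
    calc x * (-log x) ≤ x * (x⁻¹ - 1) := mul_le_mul_of_nonneg_left this hx.1.le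
      _ = 1 - x := by rw [mul_sub, mul_inv_cancel₀ hx.1.ne', mul_one]
      _ ≤ 1 := by linarith [hx.1]
  rw [hsplit, abs_of_nonneg (by nlinarith)]
  calc x ^ (p - e) - x ^ (p - e) * x ^ e = x ^ (p - e) * (1 - x ^ e) := by ring
    _ ≤ x * (e * -log x) := by
      apply mul_le_mul h1 (by linarith) (by linarith) hx.1.le
    _ = e * (x * -log x) := by ring
    _ ≤ e * 1 := by gcongr
    _ = e := mul_one e

/-- Strong monotonicity of the one-dimensional Pucci operator. -/
lemma mul_sub_le_pucci_sub {lam Lam a b : ℝ} (hlL : lam ≤ Lam) (hab : b ≤ a) :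
    lam * (a - b) ≤ (Lam * max a 0 + lam * min a 0) - (Lam * max b 0 + lam * min b 0) := by
  rcases le_total a 0 with ha | ha <;> rcases le_total b 0 with hb | hb <;>
    simp only [ha, hb, max_eq_left, max_eq_right, min_eq_left, min_eq_right] <;> nlinarith

section Comparison

variable {lam Lam k p e T : ℝ} {y z : ℝ → ℝ}

lemma le_of_pucci_sub_eq {a b f c : ℝ} (hlam : 0 < lam) (hlL : lam ≤ Lam) (hc : 0 ≤ c)
    (h : (Lam * max a 0 + lam * min a 0) - (Lam * max b 0 + lam * min b 0) = -f - c) :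
    a - b ≤ |f| / lam := by
  rw [le_div_iff₀ hlam]
  rcases le_total b a with hab | hab
  · have := mul_sub_le_pucci_sub hlL hab
    linarith [neg_abs_le f]
  · nlinarith [abs_nonneg f]

lemma abs_le_of_pucci_sub_eq {a b f c : ℝ} (hlam : 0 < lam) (hlL : lam ≤ Lam)
    (h : (Lam * max a 0 + lam * min a 0) - (Lam * max b 0 + lam * min b 0) = -f - c) :
    |a - b| ≤ (|f| + |c|) / lam := by
  rw [le_div_iff₀ hlam]
  rcases le_total b a with hab | hab
  · have := mul_sub_le_pucci_sub hlL hab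
    rw [abs_of_nonneg (by linarith)]
    linarith [neg_abs_le f, neg_abs_le c]
  · have := mul_sub_le_pucci_sub hlL hab
    rw [abs_of_nonpos (by linarith)]
    linarith [le_abs_self f, le_abs_self c]

lemma le_mul_of_deriv_le {v v' : ℝ → ℝ} {F S : ℝ} (hF : 0 ≤ F) (hcont : ContinuousOn v (Icc 0 S))
    (hv : ∀ r ∈ Ico 0 S, HasDerivWithinAt v (v' r) (Ici r) r) (h0 : v 0 = 0)
    (hle : ∀ r ∈ Ioo 0 S, 0 < v r → v' r ≤ F) : ∀ r ∈ Icc 0 S, v r ≤ F * r := by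
  intro r hr
  have key : ∀ c > 0, v r ≤ (F + c) * r + c := by
    intro c hc
    refine image_le_of_deriv_right_lt_deriv_boundary (B := fun x => (F + c) * x + c)
      (B' := fun _ => F + c) hcont hv (by simp [h0, hc.le]) (fun x => ?_) (fun x hx hxe => ?_) hr
    · simpa using ((hasDerivAt_id x).const_mul (F + c)).add_const c
    · have hpos : 0 < v x := by
        have := hx.1
        rw [hxe]
        positivity
      have hx0 : 0 < x := hx.1.lt_of_ne (by rintro rfl; linarith)
      linarith [hle x ⟨hx0, hx.2⟩ hpos]
  refine le_of_forall_pos_le_add fun δ hδ => ?_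
  have hr1 : 0 < r + 1 := by linarith [hr.1]
  have := key (δ / (r + 1)) (by positivity)
  have h : δ / (r + 1) * (r + 1) = δ := div_mul_cancel₀ _ hr1.ne'
  linarith

lemma RadialIVP.sub_eqn (hy : RadialIVP lam Lam k (p - e) T y) (hz : RadialIVP lam Lam k p T z)
    {r : ℝ} (hr : r ∈ Ioo 0 T) :
    (Lam * max (deriv (deriv y) r) 0 + lam * min (deriv (deriv y) r) 0) -
      (Lam * max (deriv (deriv z) r) 0 + lam * min (deriv (deriv z) r) 0) =
      -(y r ^ (p - e) - z r ^ p) - k * ((deriv y r - deriv z r) / r) := by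
  have h1 := hy.eqn r hr
  have h2 := hz.eqn r hr
  rw [sub_div]
  linarith

lemma RadialIVP.deriv₂_sub_le (hlam : 0 < lam) (hlL : lam ≤ Lam) (hk : 0 ≤ k)
    (hy : RadialIVP lam Lam k (p - e) T y) (hz : RadialIVP lam Lam k p T z)
    {r : ℝ} (hr : r ∈ Ioo 0 T) :
    (0 ≤ deriv y r - deriv z r →
      deriv (deriv y) r - deriv (deriv z) r ≤ |y r ^ (p - e) - z r ^ p| / lam) ∧
    (deriv y r - deriv z r ≤ 0 →
      -(deriv (deriv y) r - deriv (deriv z) r) ≤ |y r ^ (p - e) - z r ^ p| / lam) := by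
  have h := hy.sub_eqn hz hr
  refine ⟨fun hv => le_of_pucci_sub_eq hlam hlL (mul_nonneg hk (div_nonneg hv hr.1.le)) h,
    fun hv => ?_⟩
  rw [neg_sub, ← abs_neg]
  refine le_of_pucci_sub_eq hlam hlL (c := -(k * ((deriv y r - deriv z r) / r))) ?_ (by linarith)
  rw [← mul_neg, ← neg_div]
  exact mul_nonneg hk (div_nonneg (neg_nonneg.2 hv) hr.1.le)

lemma RadialIVP.abs_source_sub_le (he : 0 ≤ e) (hpe : 1 ≤ p - e)
    (hy : RadialIVP lam Lam k (p - e) T y) (hz : RadialIVP lam Lam k p T z)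
    {r : ℝ} (hr : r ∈ Ico 0 T) :
    |y r ^ (p - e) - z r ^ p| ≤ e + p * |y r - z r| :=
  (abs_sub_le _ (y r ^ p) _).trans <| add_le_add
    (abs_rpow_sub_exponent_le he hpe (hy.mem r hr))
    (abs_rpow_sub_rpow_le (by linarith) (hy.mem r hr) (hz.mem r hr))

lemma RadialIVP.continuousOn_deriv (hy : RadialIVP lam Lam k p T y) {S : ℝ} (hS : S < T) :
    ContinuousOn (deriv y) (Icc 0 S) := fun r hr =>
  (hy.hasDeriv₂ r ⟨hr.1, hr.2.trans_lt hS⟩).continuousAt.continuousWithinAt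

lemma RadialIVP.energy_le (hlam : 0 < lam) (hlL : lam ≤ Lam) (hk : 0 ≤ k) (he : 0 ≤ e)
    (hpe : 1 ≤ p - e) (hy : RadialIVP lam Lam k (p - e) T y) (hz : RadialIVP lam Lam k p T z)
    {r : ℝ} (hr : r ∈ Ico 0 T) :
    (y r - z r) ^ 2 + (deriv y r - deriv z r) ^ 2 ≤
      gronwallBound 0 (1 + 2 * p / lam) (e / lam) r := by
  have hp : 0 ≤ p := by linarith
  have hsub : ∀ x ∈ Ico 0 r, x ∈ Ico 0 T := fun x hx => ⟨hx.1, hx.2.trans hr.2⟩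
  have hc : ContinuousOn (fun x => (y x - z x) ^ 2 + (deriv y x - deriv z x) ^ 2) (Icc 0 r) := by
    have hsubI : Icc 0 r ⊆ Icc 0 T := Icc_subset_Icc_right hr.2.le
    exact (((hy.cont.mono hsubI).sub (hz.cont.mono hsubI)).pow 2).add
      (((hy.continuousOn_deriv hr.2).sub (hz.continuousOn_deriv hr.2)).pow 2)
  have := le_gronwallBound_of_liminf_deriv_right_le (δ := 0) (K := 1 + 2 * p / lam)
    (ε := e / lam) (f' := fun x => 2 * (y x - z x) * (deriv y x - deriv z x) +
      2 * (deriv y x - deriv z x) * (deriv (deriv y) x - deriv (deriv z) x)) hc ?_ ?_ ?_ r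
      (right_mem_Icc.2 hr.1)
  · simpa using this
  · intro x hx s hs
    have hx' := hsub x hx
    have hd := ((((hy.hasDeriv x hx').sub (hz.hasDeriv x hx')).pow 2).add
      ((((hy.hasDeriv₂ x hx').sub (hz.hasDeriv₂ x hx')).hasDerivWithinAt (s := Ici x)).pow 2))
    refine HasDerivWithinAt.liminf_right_slope_le (hd.congr_deriv ?_) hs
    simp
  · simp [hy.zero, hz.zero, hy.deriv_zero, hz.deriv_zero]
  · intro x hx
    have hx' := hsub x hx
    rcases hx.1.eq_or_lt with rfl | h0
    · simp only [hy.zero, hz.zero, hy.deriv_zero, hz.deriv_zero]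
      simp only [sub_self, mul_zero, zero_mul, add_zero]
      positivity
    · obtain ⟨h1, h2⟩ := hy.deriv₂_sub_le hlam hlL hk hz ⟨h0, hx'.2⟩
      have hf := hy.abs_source_sub_le he hpe hz hx'
      generalize y x - z x = w at *
      generalize deriv y x - deriv z x = v at *
      generalize deriv (deriv y) x - deriv (deriv z) x = v' at *
      have hvv : v * v' ≤ |v| * ((e + p * |w|) / lam) := by
        have hf' := div_le_div_of_nonneg_right hf hlam.le
        rcases le_total 0 v with hv | hv
        · rw [abs_of_nonneg hv]
          exact mul_le_mul_of_nonneg_left ((h1 hv).trans hf') hv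
        · rw [abs_of_nonpos hv, ← neg_mul_neg]
          exact mul_le_mul_of_nonneg_left ((h2 hv).trans hf') (neg_nonneg.2 hv)
      have hin : 2 * (|v| * (e + p * |w|)) ≤ 2 * p * (w ^ 2 + v ^ 2) + e := by
        have hep : e ≤ p := by linarith
        have i1 : 2 * |v| ≤ 1 + v ^ 2 := by nlinarith [sq_nonneg (|v| - 1), sq_abs v]
        have i2 : 2 * (|v| * |w|) ≤ w ^ 2 + v ^ 2 := by
          nlinarith [sq_nonneg (|v| - |w|), sq_abs v, sq_abs w]
        have i3 := mul_le_mul_of_nonneg_left i1 he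
        have i4 := mul_le_mul_of_nonneg_left i2 hp
        have i5 := mul_le_mul_of_nonneg_right hep (sq_nonneg v)
        have i6 := mul_nonneg hp (sq_nonneg w)
        linarith
      have hin' := div_le_div_of_nonneg_right hin hlam.le
      have hwv : 2 * w * v ≤ w ^ 2 + v ^ 2 := two_mul_le_add_sq w v
      have e1 : 2 * (|v| * (e + p * |w|)) / lam = 2 * (|v| * ((e + p * |w|) / lam)) := by ring
      have e2 : (2 * p * (w ^ 2 + v ^ 2) + e) / lam =
        2 * p / lam * (w ^ 2 + v ^ 2) + e / lam := by ring
      rw [e1, e2] at hin'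
      linarith

lemma RadialIVP.mono (hy : RadialIVP lam Lam k p T y) {S : ℝ} (hS : S ≤ T) :
    RadialIVP lam Lam k p S y where
  cont := hy.cont.mono (Icc_subset_Icc_right hS)
  hasDeriv r hr := hy.hasDeriv r ⟨hr.1, hr.2.trans_le hS⟩
  hasDeriv₂ r hr := hy.hasDeriv₂ r ⟨hr.1, hr.2.trans_le hS⟩
  zero := hy.zero
  deriv_zero := hy.deriv_zero
  mem r hr := hy.mem r ⟨hr.1, hr.2.trans_le hS⟩
  eqn r hr := hy.eqn r ⟨hr.1, hr.2.trans_le hS⟩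

lemma RadialIVP.abs_deriv_sub_le (hlam : 0 < lam) (hlL : lam ≤ Lam) (hk : 0 ≤ k) (he : 0 ≤ e)
    (hpe : 1 ≤ p - e) (hy : RadialIVP lam Lam k (p - e) T y) (hz : RadialIVP lam Lam k p T z)
    {s : ℝ} (hs : ∀ x ∈ Ico 0 T, |y x - z x| ≤ s) {r : ℝ} (hr : r ∈ Ico 0 T) :
    |deriv y r - deriv z r| ≤ (e + p * s) / lam * r := by
  have hp : 0 ≤ p := by linarith
  have hs0 : 0 ≤ s := (abs_nonneg _).trans (hs r hr)
  have hF : 0 ≤ (e + p * s) / lam := by positivity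
  have hsub : ∀ x ∈ Ico 0 r, x ∈ Ico 0 T := fun x hx => ⟨hx.1, hx.2.trans hr.2⟩
  have hf : ∀ x ∈ Ioo 0 r, |y x ^ (p - e) - z x ^ p| / lam ≤ (e + p * s) / lam := by
    intro x hx
    have hx' := hsub x ⟨hx.1.le, hx.2⟩
    gcongr
    exact (hy.abs_source_sub_le he hpe hz hx').trans (by gcongr; exact hs x hx')
  have hc := (hy.continuousOn_deriv hr.2).sub (hz.continuousOn_deriv hr.2)
  have hd : ∀ x ∈ Ico 0 r, HasDerivWithinAt (deriv y - deriv z)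
      (deriv (deriv y) x - deriv (deriv z) x) (Ici x) x := fun x hx =>
    ((hy.hasDeriv₂ x (hsub x hx)).sub (hz.hasDeriv₂ x (hsub x hx))).hasDerivWithinAt
  have hlt : ∀ x ∈ Ioo 0 r, x ∈ Ioo 0 T := fun x hx => ⟨hx.1, hx.2.trans hr.2⟩
  rw [abs_le']
  constructor
  · refine le_mul_of_deriv_le hF hc hd (by simp [hy.deriv_zero, hz.deriv_zero])
      (fun x hx hv => ?_) r (right_mem_Icc.2 hr.1)
    exact ((hy.deriv₂_sub_le hlam hlL hk hz (hlt x hx)).1 hv.le).trans (hf x hx)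
  · refine le_mul_of_deriv_le hF hc.neg (fun x hx => (hd x hx).neg)
      (by simp [hy.deriv_zero, hz.deriv_zero])
      (fun x hx hv => ?_) r (right_mem_Icc.2 hr.1)
    exact ((hy.deriv₂_sub_le hlam hlL hk hz (hlt x hx)).2 (neg_pos.1 hv).le).trans (hf x hx)

/-- If two profiles are `s`-close on `[0, T)`, then their second derivatives are close as well. -/
lemma RadialIVP.abs_deriv₂_sub_le (hlam : 0 < lam) (hlL : lam ≤ Lam) (hk : 0 ≤ k) (he : 0 ≤ e)
    (hpe : 1 ≤ p - e) (hy : RadialIVP lam Lam k (p - e) T y) (hz : RadialIVP lam Lam k p T z)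
    {s : ℝ} (hs : ∀ x ∈ Ico 0 T, |y x - z x| ≤ s) {r : ℝ} (hr : r ∈ Ico 0 T) :
    |deriv (deriv y) r - deriv (deriv z) r| ≤
      (e + p * s) / lam + k * ((e + p * s) / lam) / lam := by
  have hp : 0 ≤ p := by linarith
  have hs0 : 0 ≤ s := (abs_nonneg _).trans (hs r hr)
  have hF : 0 ≤ (e + p * s) / lam := by positivity
  have hv := fun x hx => hy.abs_deriv_sub_le hlam hlL hk he hpe hz hs (r := x) hx
  rcases hr.1.eq_or_lt with rfl | h0
  · have hlim := ((hy.hasDeriv₂ 0 hr).sub (hz.hasDeriv₂ 0 hr)).tendsto_slope_zero_right.abs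
    have hle : |deriv (deriv y) 0 - deriv (deriv z) 0| ≤ (e + p * s) / lam := by
      refine le_of_tendsto hlim ?_
      filter_upwards [Ioo_mem_nhdsGT hr.2] with t ht
      have := hv t ⟨ht.1.le, ht.2⟩
      simp only [zero_add, Pi.sub_apply, hy.deriv_zero, hz.deriv_zero, sub_self, sub_zero,
        smul_eq_mul, abs_mul, abs_inv, abs_of_pos ht.1]
      rw [inv_mul_le_iff₀ ht.1]
      linarith
    have : 0 ≤ k * ((e + p * s) / lam) / lam := by positivity
    linarith
  · refine (abs_le_of_pucci_sub_eq hlam hlL (hy.sub_eqn hz ⟨h0, hr.2⟩)).trans ?_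
    rw [add_div]
    gcongr
    · exact (hy.abs_source_sub_le he hpe hz hr).trans (by gcongr; exact hs r hr)
    · rw [abs_mul, abs_of_nonneg hk, abs_div, abs_of_pos h0]
      refine mul_le_mul_of_nonneg_left ?_ hk
      rw [div_le_iff₀ h0]
      exact hv r hr

/-- Continuous dependence of the radial initial value problem on the exponent. -/
lemma RadialIVP.exists_modulus (hlam : 0 < lam) (hlL : lam ≤ Lam) (hk : 0 ≤ k) (hp : 0 ≤ p)
    (R : ℝ) :
    ∃ ω : ℝ → ℝ, Tendsto ω (𝓝 0) (𝓝 0) ∧ ∀ e T y z, 0 ≤ e → 1 ≤ p - e → T ≤ R →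
      RadialIVP lam Lam k (p - e) T y → RadialIVP lam Lam k p T z → ∀ r ∈ Ico 0 T,
        |y r - z r| + |deriv y r - deriv z r| + |deriv (deriv y) r - deriv (deriv z) r| ≤ ω e := by
  let s : ℝ → ℝ := fun e => √(gronwallBound 0 (1 + 2 * p / lam) (e / lam) R)
  have hs : Continuous s := ((gronwallBound_continuous_ε _ _ _).comp
    (continuous_id.div_const lam)).sqrt
  have hs0 : s 0 = 0 := by simp [s, gronwallBound_ε0_δ0]
  refine ⟨fun e => s e + s e + ((e + p * s e) / lam + k * ((e + p * s e) / lam) / lam),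
    ?_, ?_⟩
  · refine Continuous.tendsto' (by fun_prop) _ _ ?_
    simp [hs0]
  · intro e T y z he hpe hTR hy hz r hr
    have hE : ∀ x ∈ Ico 0 T, (y x - z x) ^ 2 + (deriv y x - deriv z x) ^ 2 ≤
        gronwallBound 0 (1 + 2 * p / lam) (e / lam) R := fun x hx =>
      (hy.energy_le hlam hlL hk he hpe hz hx).trans
        (gronwallBound_mono le_rfl (by positivity) (by positivity) (hx.2.le.trans hTR))
    have hw : ∀ x ∈ Ico 0 T, |y x - z x| ≤ s e := fun x hx =>
      abs_le_sqrt (by linarith [hE x hx, sq_nonneg (deriv y x - deriv z x)])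
    exact add_le_add (add_le_add (hw r hr)
      (abs_le_sqrt (by linarith [hE r hr, sq_nonneg (y r - z r)])))
      (hy.abs_deriv₂_sub_le hlam hlL hk he hpe hz hw hr)

end Comparison

lemma IsEntireSol.radialIVP {lam Lam Ntil p c1 R0 T : ℝ} {N : ℕ} {U : ℝ → ℝ}
    (hU : IsEntireSol lam Lam N Ntil p c1 R0 U) (hT : 0 < T) :
    RadialIVP lam Lam (((N : ℝ) - 1) * lam) p T U := by
  obtain ⟨hC, hpos, h0, hd, hneg, heq, hR0, h2, -⟩ := hU
  exact RadialIVP.of_contDiffOn hT (hC.mono Icc_subset_Ici_self) (h2 0 ⟨le_rfl, hR0⟩).ne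
    (fun r hr => hpos r hr.1) h0 hd (fun r hr => (hneg r hr.1).le) (fun r hr => heq r hr.1)

/-- Convergence in `C²_loc([0,∞))` of the rescaled solutions
`ũₙ(r) = Mₙ⁻¹ uₙ(Mₙ^{−(pₙ−1)/2} r)` to the fast-decaying entire solution `U`. -/
theorem stmt_5 (lam Lam : ℝ) (N : ℕ) (Ntil pstar c1 R0 : ℝ)
    (hlam : 0 < lam) (hlL : lam ≤ Lam) (hN : 2 ≤ N)
    (hNtil : Ntil = lam / Lam * ((N : ℝ) - 1) + 1) (hNtil2 : 2 < Ntil)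
    (hpstar : 1 < pstar)
    (U : ℝ → ℝ) (hU : IsEntireSol lam Lam N Ntil pstar c1 R0 U)
    (hnonex : ¬ ∃ w : ℝ → ℝ, IsDirichletSol lam Lam N pstar w)
    (ε : ℕ → ℝ) (hε : ∀ n, 0 < ε n) (hε0 : Tendsto ε atTop (nhds 0))
    (hpn : ∀ n, 1 < pstar - ε n)
    (u : ℕ → ℝ → ℝ) (hu : ∀ n, IsDirichletSol lam Lam N (pstar - ε n) (u n))
    (r0 : ℕ → ℝ) (hr0 : ∀ n, InflectionAt (u n) (r0 n))
    (tilde : ℕ → ℝ → ℝ)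
    (htilde : ∀ n, tilde n =
      fun r => (u n 0)⁻¹ * u n ((u n 0) ^ (-(pstar - ε n - 1) / 2) * r)) :
    ∀ R > 0, ∀ δ > 0, ∃ n0 : ℕ, ∀ n ≥ n0,
      R ≤ (u n 0) ^ ((pstar - ε n - 1) / 2) ∧
      ∀ r ∈ Set.Icc (0 : ℝ) R,
        |tilde n r - U r| + |deriv (tilde n) r - deriv U r| +
          |deriv (deriv (tilde n)) r - deriv (deriv U) r| < δ := by
  have hk : 0 ≤ ((N : ℝ) - 1) * lam := by
    have : (2 : ℝ) ≤ N := by exact_mod_cast hN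
    exact mul_nonneg (by linarith) hlam.le
  intro R hR δ hδ
  obtain ⟨ω, hω, hmod⟩ := RadialIVP.exists_modulus (p := pstar) hlam hlL hk (by linarith) (R + 1)
  obtain ⟨m, hm, hmU⟩ : ∃ m > 0, ∀ r ∈ Icc 0 (R + 1), m ≤ U r := by
    obtain ⟨x, hx, hmin⟩ := isCompact_Icc.exists_isMinOn (nonempty_Icc.2 (by linarith))
      (hU.radialIVP (by linarith : 0 < R + 1)).cont
    exact ⟨U x, hU.2.1 x hx.1, fun r hr => hmin hr⟩
  obtain ⟨n0, hn0⟩ := eventually_atTop.1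
    ((hω.comp hε0).eventually (gt_mem_nhds (lt_min hδ hm)))
  refine ⟨n0, fun n hn => ?_⟩
  obtain ⟨hωδ, hωm⟩ := lt_min_iff.1 (hn0 n hn)
  have hM : 0 < u n 0 := (hu n).2.1 0 (by simp)
  have hy := (hu n).rescale ((hr0 n).2.1 0 ⟨le_rfl, (hr0 n).1.1⟩).ne
  rw [← htilde n] at hy
  set ρ := u n 0 ^ ((pstar - ε n - 1) / 2) with hρ
  have hρ0 : 0 < ρ := rpow_pos_of_pos hM _
  have hyρ : tilde n ρ = 0 := by
    have : u n 0 ^ (-(pstar - ε n - 1) / 2) * ρ = 1 := by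
      rw [hρ, ← rpow_add hM]
      ring_nf
      simp
    simp only [htilde n]
    rw [this, (hu n).2.2.1, mul_zero]
  have hclose : ∀ T, 0 < T → T ≤ ρ → T ≤ R + 1 → ∀ r ∈ Ico 0 T,
      |tilde n r - U r| + |deriv (tilde n) r - deriv U r| +
        |deriv (deriv (tilde n)) r - deriv (deriv U) r| ≤ ω (ε n) := fun T hT hTρ hTR =>
    hmod (ε n) T (tilde n) U (hε n).le (hpn n).le hTR (hy.mono hTρ) (hU.radialIVP hT)
  have hlarge : R + 1 < ρ := by
    by_contra! hle
    have hcont : ContinuousWithinAt (fun r => |tilde n r - U r|) (Ico 0 ρ) ρ :=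
      ((hy.cont.sub (hU.radialIVP hρ0).cont).abs ρ (right_mem_Icc.2 hρ0.le)).mono
        Ico_subset_Icc_self
    have hmem : ρ ∈ closure (Ico 0 ρ) := by
      rw [closure_Ico hρ0.ne]
      exact right_mem_Icc.2 hρ0.le
    have hlim : |tilde n ρ - U ρ| ≤ ω (ε n) := by
      have _ := mem_closure_iff_nhdsWithin_neBot.1 hmem
      refine le_of_tendsto hcont ?_
      filter_upwards [self_mem_nhdsWithin] with r hr
      have := hclose ρ hρ0 le_rfl hle r hr
      linarith [abs_nonneg (deriv (tilde n) r - deriv U r),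
        abs_nonneg (deriv (deriv (tilde n)) r - deriv (deriv U) r)]
    rw [hyρ, zero_sub, abs_neg] at hlim
    have h1 := hmU ρ ⟨hρ0.le, hle⟩
    have h2 := le_abs_self (U ρ)
    simp only [Function.comp_apply] at hωm
    linarith
  refine ⟨by linarith, fun r hr => ?_⟩
  exact (hclose (R + 1) (by linarith) hlarge.le le_rfl r ⟨hr.1, by linarith [hr.2]⟩).trans_lt hωδ
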